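/- arXiv:1607.04690 — 2 statements merged into one kernel-verified Lean document; each statement's English description precedes it below -/
import Mathlib

section
/- Let X₁, X₂ and Y be probabilistic coherence spaces and let t ∈ (ℝ≥0)^{(|X₁|×|X₂|)×|Y|}. Then t is a morphism from X₁⊗X₂ to Y (i.e., t·w ∈ P(Y) for all w ∈ P(X₁⊗X₂)) if and only if for all u₁ ∈ P(X₁) and u₂ ∈ P(X₂) one has t·(u₁⊗u₂) ∈ P(Y). -/
open scoped ENNReal NNReal Classical

noncomputable section

namespace PCS

variable {I J K : Type*}

/-- Pairing `⟨u,u'⟩ = Σ_a u_a u'_a`, valued in `[0,∞]`. -/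
def pair (u u' : I → ℝ≥0) : ℝ≥0∞ := ∑' a, (u a : ℝ≥0∞) * (u' a : ℝ≥0∞)

/-- Orthogonal of a set of nonnegative families. -/
def orth (F : Set (I → ℝ≥0)) : Set (I → ℝ≥0) := {u' | ∀ u ∈ F, pair u u' ≤ 1}

/-- `P` is (the set of vectors of) a probabilistic coherence space on the web `I`. -/
structure IsPCS (P : Set (I → ℝ≥0)) : Prop where
  biorth : orth (orth P) = P
  pos : ∀ a : I, ∃ u ∈ P, 0 < u a
  bdd : ∀ a : I, ∃ A : ℝ≥0, 0 < A ∧ ∀ u ∈ P, u a ≤ A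

/-- Application of a matrix to a vector: `(t·u)_b = Σ_a t_{a,b} u_a ∈ [0,∞]`. -/
def matApp (t : I × J → ℝ≥0) (u : I → ℝ≥0) : J → ℝ≥0∞ :=
  fun b => ∑' a, (t (a, b) : ℝ≥0∞) * (u a : ℝ≥0∞)

/-- Application for `[0,∞]`-valued matrices/vectors. -/
def matAppE (t : I × J → ℝ≥0∞) (u : I → ℝ≥0∞) : J → ℝ≥0∞ :=
  fun b => ∑' a, t (a, b) * u a

/-- A `[0,∞]`-valued vector belongs to `Q ⊆ (ℝ≥0)^J` if it is pointwise the coercion of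
an element of `Q` (in particular it is everywhere finite). -/
def memP (Q : Set (J → ℝ≥0)) (v : J → ℝ≥0∞) : Prop :=
  ∃ w ∈ Q, ∀ b, v b = (w b : ℝ≥0∞)

/-- `t` is a morphism from `(I,P)` to `(J,Q)`: `t·u ∈ Q` for every `u ∈ P`. -/
def IsMorphism (t : I × J → ℝ≥0) (P : Set (I → ℝ≥0)) (Q : Set (J → ℝ≥0)) : Prop :=
  ∀ u ∈ P, memP Q (matApp t u)

/-- Matrix composition `(t ∘ s)_{a,c} = Σ_b s_{a,b} t_{b,c}`, in `[0,∞]`. -/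
def matComp (s : I × J → ℝ≥0) (t : J × K → ℝ≥0) : I × K → ℝ≥0∞ :=
  fun p => ∑' b, (s (p.1, b) : ℝ≥0∞) * (t (b, p.2) : ℝ≥0∞)

/-- Composition of `[0,∞]`-valued matrices. -/
def matCompE (s : I × J → ℝ≥0∞) (t : J × K → ℝ≥0∞) : I × K → ℝ≥0∞ :=
  fun p => ∑' b, s (p.1, b) * t (b, p.2)

/-- Set of simple tensors `u⊗v` with `u ∈ P`, `v ∈ Q`. -/
def tensSet (P : Set (I → ℝ≥0)) (Q : Set (J → ℝ≥0)) : Set (I × J → ℝ≥0) :=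
  {w | ∃ u ∈ P, ∃ v ∈ Q, w = fun p => u p.1 * v p.2}

/-- `P(X⊗Y)`: biorthogonal closure of the simple tensors. -/
def tensorP (P : Set (I → ℝ≥0)) (Q : Set (J → ℝ≥0)) : Set (I × J → ℝ≥0) :=
  orth (orth (tensSet P Q))

/-- `P(X⊸Y) = P((X ⊗ Y⊥)⊥)`. -/
def limplP (P : Set (I → ℝ≥0)) (Q : Set (J → ℝ≥0)) : Set (I × J → ℝ≥0) :=
  orth (tensorP P (orth Q))

/-- Norm `‖u‖_X = sup{⟨u,u'⟩ : u' ∈ P(X)⊥}`. -/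
def normE (P : Set (I → ℝ≥0)) (u : I → ℝ≥0) : ℝ≥0∞ :=
  ⨆ u' ∈ orth P, pair u u'

/-- The product `&_{i} X_i`. -/
def withP {ι : Type*} {A : ι → Type*} (P : ∀ i, Set (A i → ℝ≥0)) :
    Set ((Σ i, A i) → ℝ≥0) :=
  {u | ∀ i, (fun a => u ⟨i, a⟩) ∈ P i}

/-- The coproduct `⊕_{i} X_i = (&_{i} X_i⊥)⊥`. -/
def plusP {ι : Type*} {A : ι → Type*} (P : ∀ i, Set (A i → ℝ≥0)) :
    Set ((Σ i, A i) → ℝ≥0) :=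
  orth (withP fun i => orth (P i))

/-- Projection matrix `π_i`. -/
def projMat {ι : Type*} {A : ι → Type*} (i : ι) : ((Σ j, A j) × A i) → ℝ≥0 :=
  fun p => if p.1 = ⟨i, p.2⟩ then 1 else 0

/-- Injection matrix `in_j`. -/
def injMat {ι : Type*} {A : ι → Type*} (j : ι) : (A j × Σ i, A i) → ℝ≥0 :=
  fun p => if p.2 = ⟨j, p.1⟩ then 1 else 0

/-- `u^m = Π_a u_a^{m(a)}`. -/
def mpow (u : I → ℝ≥0) (m : Multiset I) : ℝ≥0 := (m.map u).prod

/-- `v^m` for `[0,∞]`-valued `v`. -/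
def mpowE (v : I → ℝ≥0∞) (m : Multiset I) : ℝ≥0∞ := (m.map v).prod

/-- Promotion `u^! = (u^m)_m`. -/
def promote (u : I → ℝ≥0) : Multiset I → ℝ≥0 := fun m => mpow u m

/-- `P(!X)`: biorthogonal closure of the promotions. -/
def bangP (P : Set (I → ℝ≥0)) : Set (Multiset I → ℝ≥0) :=
  orth (orth {v | ∃ u ∈ P, v = promote u})

/-- The function associated with a matrix `s ∈ (ℝ≥0)^{Mfin(I)×J}`:
`ŝ(u)_b = Σ_m s_{m,b} u^m`. -/
def fhat (s : Multiset I × J → ℝ≥0) (u : I → ℝ≥0) : J → ℝ≥0∞ :=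
  fun b => ∑' m : Multiset I, (s (m, b) : ℝ≥0∞) * (mpow u m : ℝ≥0∞)

/-- Factorial of a multiset: `m! = Π_a m(a)!`. -/
def mfact [DecidableEq I] (m : Multiset I) : ℕ :=
  (m.dedup.map fun a => (m.count a).factorial).prod

/-- Multisets over `I × J` with first marginal `c` and second marginal `d`. -/
def marg (c : Multiset I) (d : Multiset J) : Set (Multiset (I × J)) :=
  {r | r.map Prod.fst = c ∧ r.map Prod.snd = d}

/-- The exponential of a matrix: `(!t)_{c,d} = Σ_{r ∈ L(c,d)} (d!/r!) t^r`. -/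
def bangMatE [DecidableEq I] [DecidableEq J] (t : I × J → ℝ≥0∞) :
    Multiset I × Multiset J → ℝ≥0∞ :=
  fun p => ∑' r : marg p.1 p.2,
    ((mfact p.2 : ℝ≥0∞) / (mfact r.1 : ℝ≥0∞)) * mpowE t r.1

theorem pair_comm (u v : I → ℝ≥0) : pair u v = pair v u :=
  tsum_congr fun _ => mul_comm _ _

theorem subset_biorth (F : Set (I → ℝ≥0)) : F ⊆ orth (orth F) := fun u hu v hv => by
  rw [pair_comm]
  exact hv u hu

/-- `⟨t·u, y⟩ = ⟨u, tᵀ·y⟩`. -/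
theorem tsum_matApp_mul (t : I × J → ℝ≥0) (u : I → ℝ≥0) (y : J → ℝ≥0) :
    ∑' b, matApp t u b * (y b : ℝ≥0∞) =
      ∑' a, (u a : ℝ≥0∞) * ∑' b, (t (a, b) : ℝ≥0∞) * (y b : ℝ≥0∞) := by
  simp only [matApp, ← ENNReal.tsum_mul_right, ← ENNReal.tsum_mul_left]
  rw [ENNReal.tsum_comm]
  exact tsum_congr fun a => tsum_congr fun b => by ring

/-- The dual of a probabilistic coherence space is positive at every point of the web. -/
theorem IsPCS.exists_orth_pos {Q : Set (J → ℝ≥0)} (hQ : IsPCS Q) (b : J) :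
    ∃ y ∈ orth Q, 0 < y b := by
  obtain ⟨A, hA, hbd⟩ := hQ.bdd b
  refine ⟨Pi.single b A⁻¹, fun u hu => ?_, by simpa using hA⟩
  rw [pair, tsum_eq_single b fun c hc => by simp [hc]]
  rw [Pi.single_eq_same, ← ENNReal.coe_mul, ENNReal.coe_le_one_iff, ← div_eq_mul_inv]
  exact div_le_one_of_le₀ (hbd u hu) hA.le

theorem IsPCS.memP_of_forall_orth {Q : Set (J → ℝ≥0)} (hQ : IsPCS Q) {v : J → ℝ≥0∞}
    (h : ∀ y ∈ orth Q, ∑' b, v b * (y b : ℝ≥0∞) ≤ 1) : memP Q v := by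
  have hfin : ∀ b, v b ≠ ∞ := fun b hb => by
    obtain ⟨y, hy, hpos⟩ := hQ.exists_orth_pos b
    have hle := (ENNReal.le_tsum b).trans (h y hy)
    rw [hb, ENNReal.top_mul (by exact_mod_cast hpos.ne')] at hle
    simp at hle
  refine ⟨fun b => (v b).toNNReal, ?_, fun b => (ENNReal.coe_toNNReal (hfin b)).symm⟩
  rw [← hQ.biorth]
  intro y hy
  rw [pair_comm]
  simpa only [pair, ENNReal.coe_toNNReal (hfin _)] using h y hy

/-- A matrix sending a set `F`, positive at every point of the web, into a probabilistic
coherence space is a morphism on the biorthogonal closure of `F`. -/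
theorem IsPCS.isMorphism_biorth {Q : Set (J → ℝ≥0)} (hQ : IsPCS Q) {F : Set (I → ℝ≥0)}
    (hF : ∀ a, ∃ u ∈ F, 0 < u a) {t : I × J → ℝ≥0} (h : ∀ u ∈ F, memP Q (matApp t u)) :
    IsMorphism t (orth (orth F)) Q := by
  refine fun w hw => hQ.memP_of_forall_orth fun y hy => ?_
  have hle : ∀ u ∈ F,
      ∑' a, (u a : ℝ≥0∞) * ∑' b, (t (a, b) : ℝ≥0∞) * (y b : ℝ≥0∞) ≤ 1 := fun u hu => by
    obtain ⟨z, hz, hzu⟩ := h u hu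
    rw [← tsum_matApp_mul]
    simpa only [pair, hzu] using hy z hz
  have hfin : ∀ a, ∑' b, (t (a, b) : ℝ≥0∞) * (y b : ℝ≥0∞) ≠ ∞ := fun a ha => by
    obtain ⟨u, hu, hpos⟩ := hF a
    have hle := (ENNReal.le_tsum a).trans (hle u hu)
    rw [ha, ENNReal.mul_top (by exact_mod_cast hpos.ne')] at hle
    simp at hle
  have hmem : (fun a => (∑' b, (t (a, b) : ℝ≥0∞) * (y b : ℝ≥0∞)).toNNReal) ∈ orth F :=
    fun u hu => by simpa only [pair, ENNReal.coe_toNNReal (hfin _)] using hle u hu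
  have hpair := hw _ hmem
  rw [pair_comm] at hpair
  rw [tsum_matApp_mul]
  simpa only [pair, ENNReal.coe_toNNReal (hfin _)] using hpair

/-- Lemma 3.5: a matrix is a morphism from `X₁⊗X₂` to `Y` iff it sends all simple
tensors of elements of `P(X₁)`, `P(X₂)` into `P(Y)`. -/
theorem tensor_morphism_charact {I₁ I₂ J : Type*} [Countable I₁] [Countable I₂] [Countable J]
    (P₁ : Set (I₁ → ℝ≥0)) (P₂ : Set (I₂ → ℝ≥0)) (Q : Set (J → ℝ≥0))
    (h₁ : IsPCS P₁) (h₂ : IsPCS P₂) (hQ : IsPCS Q)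
    (t : (I₁ × I₂) × J → ℝ≥0) :
    IsMorphism t (tensorP P₁ P₂) Q ↔
      ∀ u₁ ∈ P₁, ∀ u₂ ∈ P₂, memP Q (matApp t (fun p : I₁ × I₂ => u₁ p.1 * u₂ p.2)) := by
  constructor
  · exact fun h u₁ hu₁ u₂ hu₂ => h _ (subset_biorth _ ⟨u₁, hu₁, u₂, hu₂, rfl⟩)
  · intro h
    refine hQ.isMorphism_biorth (fun a => ?_) ?_
    · obtain ⟨u₁, hu₁, hpos₁⟩ := h₁.pos a.1
      obtain ⟨u₂, hu₂, hpos₂⟩ := h₂.pos a.2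
      exact ⟨_, ⟨u₁, hu₁, u₂, hu₂, rfl⟩, mul_pos hpos₁ hpos₂⟩
    · rintro _ ⟨u₁, hu₁, u₂, hu₂, rfl⟩
      exact h u₁ hu₁ u₂ hu₂

end PCS
end
end

section
/- Let X, Y, Z be probabilistic coherence spaces. For every t ∈ PCOH(X,Y), the matrix !t (defined by (!t)_{c,d} = Σ_{r∈L(c,d)} (d!/r!) t^r with L(c,d) the set of finite multisets over |X|×|Y| with first marginal c and second marginal d) is a morphism in PCOH(!X, !Y). Moreover this operation is functorial: !(id_X) = id_{!X} and !(t∘s) = (!t)∘(!s) for all s ∈ PCOH(X,Y), t ∈ PCOH(Y,Z). -/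
open scoped ENNReal NNReal Classical

noncomputable section

namespace PCS

variable {I J K : Type*}

lemma mfact_eq_prod [DecidableEq I] (m : Multiset I) (S : Finset I) (h : m.toFinset ⊆ S) :
    mfact m = ∏ a ∈ S, (m.count a).factorial := by
  rw [← Finset.prod_subset h fun a _ ha => ?_]
  · rfl
  · rw [Multiset.count_eq_zero_of_notMem (by simpa using ha), Nat.factorial_zero]

lemma mfact_cons [DecidableEq I] (a : I) (m : Multiset I) :
    mfact (a ::ₘ m) = (m.count a + 1) * mfact m := by
  have ha : a ∈ (a ::ₘ m).toFinset := by simp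
  rw [mfact_eq_prod (a ::ₘ m) _ subset_rfl,
    mfact_eq_prod m (a ::ₘ m).toFinset (by simp [Finset.subset_insert]),
    ← Finset.mul_prod_erase _ _ ha, ← Finset.mul_prod_erase _ _ ha, Multiset.count_cons_self,
    Nat.factorial_succ, mul_assoc]
  congr 2
  refine Finset.prod_congr rfl fun b hb => ?_
  rw [Multiset.count_cons_of_ne (Finset.ne_of_mem_erase hb)]

lemma mfact_ne_zero [DecidableEq I] (m : Multiset I) : mfact m ≠ 0 := by
  rw [mfact_eq_prod m _ subset_rfl]
  exact Finset.prod_ne_zero_iff.2 fun a _ => Nat.factorial_ne_zero _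

lemma tsum_count_prod [DecidableEq I] [DecidableEq J] (b : J) (r : Multiset (I × J)) :
    ∑' a : I, ((r.count (a, b) : ℕ) : ℝ≥0∞) = ((r.map Prod.snd).count b : ℕ) := by
  induction r using Multiset.induction with
  | empty => simp
  | cons x r ih =>
    obtain ⟨i, j⟩ := x
    simp only [Multiset.count_cons, Multiset.map_cons, Nat.cast_add, ENNReal.tsum_add, ih]
    congr 1
    rw [tsum_eq_single i fun a ha => by simp [ha]]
    simp

/-- A weighted sum over the matrices of second marginal `b ::ₘ d` is obtained by choosing which
entry `(a, b)` to remove. -/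
lemma tsum_snd_marginal_cons [DecidableEq I] [DecidableEq J] (b : J) (d : Multiset J)
    (G : Multiset (I × J) → ℝ≥0∞) :
    ∑' r : Multiset (I × J), (if r.map Prod.snd = b ::ₘ d then
        (mfact (b ::ₘ d) : ℝ≥0∞) / mfact r * G r else 0)
      = ∑' (a : I) (r : Multiset (I × J)), if r.map Prod.snd = d then
        (mfact d : ℝ≥0∞) / mfact r * G ((a, b) ::ₘ r) else 0 := by
  have remove : ∀ a : I, (∑' r : Multiset (I × J), if r.map Prod.snd = d then
        (mfact d : ℝ≥0∞) / mfact r * G ((a, b) ::ₘ r) else 0)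
      = ∑' r : Multiset (I × J), ((r.count (a, b) : ℕ) : ℝ≥0∞) *
        (if r.map Prod.snd = b ::ₘ d then (mfact d : ℝ≥0∞) / mfact r * G r else 0) := by
    intro a
    symm
    rw [← Function.Injective.tsum_eq (g := fun r => (a, b) ::ₘ r)
      (fun _ _ h => (Multiset.cons_inj_right _).1 h)]
    · refine tsum_congr fun r => ?_
      simp only [Multiset.map_cons, Multiset.cons_inj_right, Multiset.count_cons_self, mfact_cons]
      split_ifs
      · rw [← mul_assoc]
        congr 1
        have h0 : ((r.count (a, b) + 1 : ℕ) : ℝ≥0∞) ≠ 0 := by simp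
        rw [Nat.cast_mul, ← mul_div_assoc,
          ENNReal.mul_div_mul_left _ _ h0 (ENNReal.natCast_ne_top _)]
      · simp
    · intro r hr
      have : (a, b) ∈ r := by
        by_contra h
        simp [Multiset.count_eq_zero_of_notMem h] at hr
      exact ⟨r.erase (a, b), Multiset.cons_erase this⟩
  simp_rw [remove]
  rw [ENNReal.tsum_comm]
  refine tsum_congr fun r => ?_
  rw [ENNReal.tsum_mul_right, tsum_count_prod]
  split_ifs with h
  · rw [h, Multiset.count_cons_self, mfact_cons, Nat.cast_mul, ← mul_assoc, mul_div_assoc]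
  · simp

lemma matAppE_bangMatE [DecidableEq I] [DecidableEq J] (s : I × J → ℝ≥0∞)
    (F : Multiset I → ℝ≥0∞) (d : Multiset J) :
    matAppE (bangMatE s) F d = ∑' r : Multiset (I × J), if r.map Prod.snd = d then
      (mfact d : ℝ≥0∞) / mfact r * (mpowE s r * F (r.map Prod.fst)) else 0 := by
  have entry : ∀ c, bangMatE s (c, d) * F c = ∑' r : Multiset (I × J),
      if r.map Prod.fst = c then (if r.map Prod.snd = d then
        (mfact d : ℝ≥0∞) / mfact r * (mpowE s r * F (r.map Prod.fst)) else 0) else 0 := by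
    intro c
    simp only [bangMatE]
    rw [tsum_subtype (marg c d)
      (fun r => (mfact d : ℝ≥0∞) / (mfact r : ℝ≥0∞) * mpowE s r), ← ENNReal.tsum_mul_right]
    refine tsum_congr fun r => ?_
    by_cases h1 : r.map Prod.fst = c <;> by_cases h2 : r.map Prod.snd = d <;>
      simp [Set.indicator, marg, h1, h2, mul_assoc]
  simp only [matAppE, entry]
  rw [ENNReal.tsum_comm]
  refine tsum_congr fun r => ?_
  rw [tsum_eq_single (r.map Prod.fst) fun c hc => if_neg hc.symm, if_pos rfl]

lemma matAppE_bangMatE_zero [DecidableEq I] [DecidableEq J] (s : I × J → ℝ≥0∞)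
    (F : Multiset I → ℝ≥0∞) : matAppE (bangMatE s) F 0 = F 0 := by
  rw [matAppE_bangMatE, tsum_eq_single 0 fun r hr => if_neg (by simpa using hr)]
  simp [mfact, mpowE]

lemma matAppE_bangMatE_cons [DecidableEq I] [DecidableEq J] (s : I × J → ℝ≥0∞)
    (F : Multiset I → ℝ≥0∞) (b : J) (d : Multiset J) :
    matAppE (bangMatE s) F (b ::ₘ d)
      = ∑' a, s (a, b) * matAppE (bangMatE s) (fun c => F (a ::ₘ c)) d := by
  rw [matAppE_bangMatE, tsum_snd_marginal_cons b d fun r => mpowE s r * F (r.map Prod.fst)]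
  refine tsum_congr fun a => ?_
  rw [matAppE_bangMatE, ← ENNReal.tsum_mul_left]
  refine tsum_congr fun r => ?_
  split_ifs
  · simp only [mpowE, Multiset.map_cons, Multiset.prod_cons]
    ring
  · simp

lemma matAppE_mul_left (M : I × J → ℝ≥0∞) (x : ℝ≥0∞) (F : I → ℝ≥0∞) (d : J) :
    matAppE M (fun c => x * F c) d = x * matAppE M F d := by
  simp only [matAppE, ← ENNReal.tsum_mul_left]
  exact tsum_congr fun c => by ring

lemma matAppE_tsum {ι : Type*} (M : I × J → ℝ≥0∞) (F : ι → I → ℝ≥0∞) (d : J) :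
    matAppE M (fun c => ∑' i, F i c) d = ∑' i, matAppE M (F i) d := by
  simp only [matAppE, ← ENNReal.tsum_mul_left]
  exact ENNReal.tsum_comm

lemma matAppE_single (M : I × J → ℝ≥0∞) (p : I × J) :
    matAppE M (fun c => if c = p.1 then 1 else 0) p.2 = M p := by
  rw [matAppE, tsum_eq_single p.1 fun c hc => by simp [hc]]
  simp

/-- `!s` maps promotions to promotions: `!s · u^! = (s·u)^!`. -/
lemma matAppE_bangMatE_mpowE [DecidableEq I] [DecidableEq J] (s : I × J → ℝ≥0∞)
    (u : I → ℝ≥0∞) (d : Multiset J) :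
    matAppE (bangMatE s) (mpowE u) d = mpowE (matAppE s u) d := by
  induction d using Multiset.induction with
  | empty => simp [matAppE_bangMatE_zero, mpowE]
  | cons b d ih =>
    have hcons : ∀ a, (fun c => mpowE u (a ::ₘ c)) = fun c => u a * mpowE u c := fun a => by
      funext c
      simp [mpowE]
    simp only [matAppE_bangMatE_cons, hcons, matAppE_mul_left, ih, ← mul_assoc]
    rw [ENNReal.tsum_mul_right]
    simp [mpowE, matAppE]

lemma matAppE_bangMatE_id [DecidableEq I] (F : Multiset I → ℝ≥0∞) (d : Multiset I) :
    matAppE (bangMatE fun q : I × I => if q.1 = q.2 then (1 : ℝ≥0∞) else 0) F d = F d := by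
  induction d using Multiset.induction generalizing F with
  | empty => exact matAppE_bangMatE_zero _ F
  | cons b d ih =>
    simp only [matAppE_bangMatE_cons, ih]
    rw [tsum_eq_single b fun a ha => by simp [ha]]
    simp

lemma matAppE_bangMatE_matCompE [DecidableEq I] [DecidableEq J] [DecidableEq K]
    (s : I × J → ℝ≥0∞) (t : J × K → ℝ≥0∞) (F : Multiset I → ℝ≥0∞) (e : Multiset K) :
    matAppE (bangMatE (matCompE s t)) F e
      = matAppE (bangMatE t) (matAppE (bangMatE s) F) e := by
  induction e using Multiset.induction generalizing F with
  | empty => simp only [matAppE_bangMatE_zero]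
  | cons k e ih =>
    simp only [matAppE_bangMatE_cons, ih, matAppE_tsum, matAppE_mul_left, matCompE,
      ← ENNReal.tsum_mul_left, ← ENNReal.tsum_mul_right]
    rw [ENNReal.tsum_comm]
    exact tsum_congr fun b => tsum_congr fun a => by ring

lemma bangMatE_matCompE [DecidableEq I] [DecidableEq J] [DecidableEq K]
    (s : I × J → ℝ≥0∞) (t : J × K → ℝ≥0∞) (p : Multiset I × Multiset K) :
    bangMatE (matCompE s t) p = matCompE (bangMatE s) (bangMatE t) p := by
  rw [← matAppE_single (bangMatE (matCompE s t)), matAppE_bangMatE_matCompE]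
  simp only [matAppE, matCompE]
  refine tsum_congr fun d => ?_
  rw [mul_comm, ← matAppE_single (bangMatE s) (p.1, d)]
  rfl

lemma finite_marg (c : Multiset I) (d : Multiset J) : (marg c d).Finite := by
  refine (Set.finite_Iic (c.card • c ×ˢ d)).subset ?_
  rintro r ⟨rfl, rfl⟩
  refine Multiset.le_iff_count.2 fun x => ?_
  by_cases hx : x ∈ r
  · rw [Multiset.count_nsmul, Multiset.card_map]
    refine (Multiset.count_le_card x r).trans (Nat.le_mul_of_pos_right _ ?_)
    rw [Multiset.count_pos, Multiset.mem_product]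
    exact ⟨Multiset.mem_map_of_mem _ hx, Multiset.mem_map_of_mem _ hx⟩
  · simp [Multiset.count_eq_zero_of_notMem hx]

lemma coe_mpow (u : I → ℝ≥0) (m : Multiset I) :
    (mpow u m : ℝ≥0∞) = mpowE (fun a => (u a : ℝ≥0∞)) m := by
  induction m using Multiset.induction with
  | empty => simp [mpow, mpowE]
  | cons a m ih =>
    simp only [mpow, mpowE, Multiset.map_cons, Multiset.prod_cons, ENNReal.coe_mul] at ih ⊢
    rw [ih]

lemma bangMatE_ne_top [DecidableEq I] [DecidableEq J] (s : I × J → ℝ≥0)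
    (p : Multiset I × Multiset J) : bangMatE (fun q => (s q : ℝ≥0∞)) p ≠ ⊤ := by
  have := (finite_marg p.1 p.2).fintype
  rw [bangMatE, tsum_fintype]
  refine ENNReal.sum_ne_top.2 fun r _ => ENNReal.mul_ne_top ?_ ?_
  · exact ENNReal.div_ne_top (ENNReal.natCast_ne_top _) (by exact_mod_cast mfact_ne_zero _)
  · rw [← coe_mpow]
    exact ENNReal.coe_ne_top

/-- If a matrix with finite entries maps generators into `Q'`, its application to the biorthogonal
of the generators pairs with the orthogonal of `Q'` as expected. -/
lemma tsum_matAppE_mul_le {F : Set (I → ℝ≥0)} {Q' : Set (J → ℝ≥0)} {M : I × J → ℝ≥0∞}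
    (hM : ∀ p, M p ≠ ⊤)
    (h : ∀ u ∈ F, memP Q' (matAppE M fun a => (u a : ℝ≥0∞)))
    {v : I → ℝ≥0} (hv : v ∈ orth (orth F)) {w : J → ℝ≥0} (hw : w ∈ orth Q') :
    ∑' b, matAppE M (fun a => (v a : ℝ≥0∞)) b * w b ≤ 1 := by
  rw [ENNReal.tsum_eq_iSup_sum]
  refine iSup_le fun S => ?_
  set w' : I → ℝ≥0 := fun a => ∑ b ∈ S, (M (a, b)).toNNReal * w b with hw'
  have transpose : ∀ u : I → ℝ≥0,
      pair u w' = ∑ b ∈ S, matAppE M (fun a => (u a : ℝ≥0∞)) b * w b := by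
    intro u
    simp only [pair, hw', matAppE, ENNReal.ofNNReal_finsetSum, ENNReal.coe_mul,
      ENNReal.coe_toNNReal (hM _), ← ENNReal.tsum_mul_right, Finset.mul_sum]
    rw [← Summable.tsum_finsetSum fun _ _ => ENNReal.summable]
    exact tsum_congr fun a => Finset.sum_congr rfl fun b _ => by ring
  have hmem : w' ∈ orth F := by
    intro u hu
    obtain ⟨x, hx, hxu⟩ := h u hu
    rw [transpose]
    simp only [hxu]
    exact (ENNReal.sum_le_tsum S).trans (hw x hx)
  have := hv w' hmem
  rw [← transpose]
  simpa only [pair, mul_comm] using this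

/-- A matrix with finite entries mapping generators to generators is a morphism between the
biorthogonals, as soon as the generators of the codomain are bounded coordinatewise. -/
lemma memP_orth_orth_matAppE {F : Set (I → ℝ≥0)} {Q' : Set (J → ℝ≥0)} {M : I × J → ℝ≥0∞}
    (hM : ∀ p, M p ≠ ⊤)
    (h : ∀ u ∈ F, memP Q' (matAppE M fun a => (u a : ℝ≥0∞)))
    (hbdd : ∀ b, ∃ A : ℝ≥0, 0 < A ∧ ∀ u ∈ Q', u b ≤ A)
    {v : I → ℝ≥0} (hv : v ∈ orth (orth F)) :
    memP (orth (orth Q')) (matAppE M fun a => (v a : ℝ≥0∞)) := by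
  have hfin : ∀ b, matAppE M (fun a => (v a : ℝ≥0∞)) b ≠ ⊤ := by
    intro b htop
    obtain ⟨A, hA, hAQ⟩ := hbdd b
    have hw : Pi.single b A⁻¹ ∈ orth Q' := by
      intro u hu
      rw [pair, tsum_eq_single b fun c hc => by simp [hc]]
      rw [Pi.single_eq_same, ← ENNReal.coe_mul, ENNReal.coe_le_one_iff, ← div_eq_mul_inv]
      exact div_le_one_of_le₀ (hAQ u hu) hA.le
    have := (ENNReal.le_tsum b).trans (tsum_matAppE_mul_le hM h hv hw)
    rw [htop, Pi.single_eq_same, ENNReal.top_mul (by simpa using hA.ne')] at this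
    exact absurd this (by simp)
  refine ⟨fun b => (matAppE M (fun a => (v a : ℝ≥0∞)) b).toNNReal, fun w hw => ?_, fun b => ?_⟩
  · have := tsum_matAppE_mul_le hM h hv hw
    simpa only [pair, ENNReal.coe_toNNReal (hfin _), mul_comm] using this
  · rw [ENNReal.coe_toNNReal (hfin b)]

lemma memP_promote_matAppE_bangMatE [DecidableEq I] [DecidableEq J] {P : Set (I → ℝ≥0)}
    {Q : Set (J → ℝ≥0)} {s : I × J → ℝ≥0} (hs : IsMorphism s P Q) {u : I → ℝ≥0} (hu : u ∈ P) :
    memP {v | ∃ u ∈ Q, v = promote u}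
      (matAppE (bangMatE fun q => (s q : ℝ≥0∞)) fun m => (promote u m : ℝ≥0∞)) := by
  obtain ⟨x, hx, hxu⟩ := hs u hu
  refine ⟨promote x, ⟨x, hx, rfl⟩, fun d => ?_⟩
  simp only [promote, coe_mpow]
  rw [matAppE_bangMatE_mpowE]
  congr 1
  funext b
  exact hxu b

lemma exists_promote_le {Q : Set (J → ℝ≥0)} (hQ : ∀ b, ∃ A : ℝ≥0, 0 < A ∧ ∀ u ∈ Q, u b ≤ A)
    (d : Multiset J) :
    ∃ A : ℝ≥0, 0 < A ∧ ∀ v ∈ {v | ∃ u ∈ Q, v = promote u}, v d ≤ A := by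
  choose A hA hAQ using hQ
  refine ⟨(d.map A).prod, ?_, ?_⟩
  · rw [pos_iff_ne_zero, Ne, Multiset.prod_eq_zero_iff, Multiset.mem_map]
    rintro ⟨b, -, hb⟩
    exact (hA b).ne' hb
  · rintro _ ⟨u, hu, rfl⟩
    exact Multiset.prod_map_le_prod_map _ _ fun b _ => hAQ b u hu

/-- Theorem 3.13: `!t` has finite entries and is a morphism `!X → !Y`, and `!` is
functorial: it preserves identities and composition. -/
theorem bang_functorial {I J K : Type*} [Countable I] [Countable J] [Countable K]
    [DecidableEq I] [DecidableEq J] [DecidableEq K]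
    (P : Set (I → ℝ≥0)) (Q : Set (J → ℝ≥0)) (R : Set (K → ℝ≥0))
    (hP : IsPCS P) (hQ : IsPCS Q) (hR : IsPCS R)
    (s : I × J → ℝ≥0) (t : J × K → ℝ≥0)
    (hs : IsMorphism s P Q) (ht : IsMorphism t Q R) :
    (∀ p : Multiset I × Multiset J, bangMatE (fun q => (s q : ℝ≥0∞)) p ≠ ⊤) ∧
    (∀ v ∈ bangP P,
        memP (bangP Q)
          (matAppE (bangMatE fun q => (s q : ℝ≥0∞)) (fun m => (v m : ℝ≥0∞)))) ∧
    (∀ p : Multiset I × Multiset I,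
        bangMatE (fun q : I × I => if q.1 = q.2 then (1 : ℝ≥0∞) else 0) p
          = if p.1 = p.2 then (1 : ℝ≥0∞) else 0) ∧
    (∀ p : Multiset I × Multiset K,
        bangMatE (matComp s t) p
          = matCompE (bangMatE fun q => (s q : ℝ≥0∞)) (bangMatE fun q => (t q : ℝ≥0∞)) p) := by
  refine ⟨bangMatE_ne_top s, fun v hv => ?_, fun p => ?_, fun p => ?_⟩
  · refine memP_orth_orth_matAppE (bangMatE_ne_top s) ?_ (exists_promote_le hQ.bdd) hv
    rintro _ ⟨u, hu, rfl⟩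
    exact memP_promote_matAppE_bangMatE hs hu
  · rw [← matAppE_single (bangMatE _) p, matAppE_bangMatE_id]
    simp only [eq_comm]
  · exact bangMatE_matCompE (fun q => (s q : ℝ≥0∞)) (fun q => (t q : ℝ≥0∞)) p

end PCS
end
end
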